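/- Let k be an odd prime and let x ∈ {0,1}^k be a non-constant binary word. Then the rotation orbit {ρ^i(x) : i ∈ ℤ/kℤ} has exactly k elements, and for all i, j ∈ ℤ/kℤ, the words ρ^i(x) and ρ^j(x) are adjacent in the simple graph underlying B(k,2) if and only if j − i ≡ 1 (mod k) or j − i ≡ −1 (mod k). -/

import Mathlib

/-- The length-(k-1) suffix of `u` equals the length-(k-1) prefix of `v`. -/
def shifts (k q : ℕ) (u v : Fin k → Fin q) : Prop :=
  ∀ i : ℕ, (h : i + 1 < k) → u ⟨i + 1, h⟩ = v ⟨i, by omega⟩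

/-- Adjacency in the simple graph underlying the de Bruijn graph B(k,q). -/
def dbAdj (k q : ℕ) (u v : Fin k → Fin q) : Prop :=
  u ≠ v ∧ (shifts k q u v ∨ shifts k q v u)

/-- The cyclic left rotation ρ on words of length k. -/
def rotate (k q : ℕ) (x : Fin k → Fin q) : Fin k → Fin q :=
  fun i => x ⟨(i.val + 1) % k, Nat.mod_lt _ (by have := i.isLt; omega)⟩

/-- A word of length `k` read as a function on `ZMod k`. -/
def cyclicWord {k q : ℕ} [NeZero k] (x : Fin k → Fin q) (a : ZMod k) : Fin q :=
  x ⟨a.val, a.val_lt⟩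

theorem rotate_iterate_apply {k q : ℕ} [NeZero k] (x : Fin k → Fin q) (n : ℕ) (m : Fin k) :
    (rotate k q)^[n] x m = cyclicWord x ((m.val : ZMod k) + n) := by
  induction n generalizing m with
  | zero => simp [cyclicWord, ZMod.val_natCast, Nat.mod_eq_of_lt m.isLt]
  | succ n ih =>
    rw [Function.iterate_succ_apply']
    simp only [rotate, ih, ZMod.natCast_mod]
    congr 1
    push_cast
    ring

/-- A non-constant word of prime length has no nontrivial period. -/
theorem period_eq_zero {k q : ℕ} [Fact k.Prime] {x : Fin k → Fin q}
    (hx : ¬ ∃ c : Fin q, ∀ i, x i = c) {d : ZMod k}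
    (hd : Function.Periodic (cyclicWord x) d) : d = 0 := by
  by_contra h
  refine hx ⟨cyclicWord x 0, fun i => ?_⟩
  have key := hd.nat_mul_eq (((i.val : ZMod k) * d⁻¹).val)
  rw [ZMod.natCast_zmod_val, inv_mul_cancel_right₀ h] at key
  rw [← key]
  simp [cyclicWord, ZMod.val_natCast, Nat.mod_eq_of_lt i.isLt]

theorem rotate_iterate_eq_iff {k q : ℕ} [Fact k.Prime] {x : Fin k → Fin q}
    (hx : ¬ ∃ c : Fin q, ∀ i, x i = c) (n m : ℕ) :
    (rotate k q)^[n] x = (rotate k q)^[m] x ↔ (n : ZMod k) = m := by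
  constructor
  · intro h
    refine sub_eq_zero.mp (period_eq_zero hx fun a => ?_)
    have := congrFun h ⟨(a - m).val, (a - m).val_lt⟩
    simp only [rotate_iterate_apply, ZMod.natCast_zmod_val, sub_add_cancel] at this
    rw [← this]
    congr 1
    ring
  · intro h
    ext1 i
    rw [rotate_iterate_apply, rotate_iterate_apply, h]

/-- Two functions on a finite type with equal sums that agree off one point agree there too. -/
theorem eq_of_sum_eq_of_forall_ne {ι : Type*} [Fintype ι] [DecidableEq ι] {f g : ι → ℕ}
    (hsum : ∑ i, f i = ∑ i, g i) (a : ι) (h : ∀ i, i ≠ a → f i = g i) : f = g := by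
  have hrest : ∑ i ∈ Finset.univ.erase a, f i = ∑ i ∈ Finset.univ.erase a, g i :=
    Finset.sum_congr rfl fun i hi => h i (Finset.ne_of_mem_erase hi)
  rw [← Finset.add_sum_erase _ f (Finset.mem_univ a),
    ← Finset.add_sum_erase _ g (Finset.mem_univ a), hrest] at hsum
  funext i
  by_cases hi : i = a
  · rw [hi]
    exact Nat.add_right_cancel hsum
  · exact h i hi

theorem shifts_rotate_iterate_iff {k q : ℕ} [Fact k.Prime] {x : Fin k → Fin q}
    (hx : ¬ ∃ c : Fin q, ∀ i, x i = c) (n m : ℕ) :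
    shifts k q ((rotate k q)^[n] x) ((rotate k q)^[m] x) ↔ (m : ZMod k) - n = 1 := by
  constructor
  · intro h
    have hagree : (fun a : ZMod k => (cyclicWord x (a + (1 + n))).val) =
        fun a => (cyclicWord x (a + m)).val := by
      refine eq_of_sum_eq_of_forall_ne ?_ (-1) fun a ha => ?_
      · exact (Equiv.sum_comp (Equiv.addRight (1 + n : ZMod k)) fun a => (cyclicWord x a).val).trans
          (Equiv.sum_comp (Equiv.addRight (m : ZMod k)) fun a => (cyclicWord x a).val).symm
      · have hlt : a.val + 1 < k := by
          refine lt_of_le_of_ne a.val_lt fun he => ha ?_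
          have := congrArg (Nat.cast : ℕ → ZMod k) he
          rw [Nat.cast_add, ZMod.natCast_zmod_val, Nat.cast_one, ZMod.natCast_self] at this
          exact eq_neg_of_add_eq_zero_left this
        have := h a.val hlt
        simp only [rotate_iterate_apply, Nat.cast_add, ZMod.natCast_zmod_val, Nat.cast_one,
          add_assoc] at this
        rw [this]
    refine sub_eq_zero.mp (period_eq_zero hx fun a => ?_)
    have := Fin.ext (congrFun hagree (a - (1 + n)))
    rw [sub_add_cancel] at this
    rw [this]
    congr 1
    ring
  · intro h i hi
    rw [rotate_iterate_apply, rotate_iterate_apply, eq_add_of_sub_eq h]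
    congr 1
    push_cast
    ring

/-- for an odd prime k and a non-constant binary word x of
length k, the rotation orbit of x has exactly k elements, and ρ^i(x) and
ρ^j(x) are adjacent in the simple graph underlying B(k,2) if and only if
j − i ≡ ±1 (mod k). -/
theorem orbit_card_and_adjacency (k : ℕ) (hk : k.Prime) (hkodd : Odd k)
    (x : Fin k → Fin 2) (hx : ¬ ∃ c : Fin 2, ∀ i, x i = c) :
    (Finset.univ.image (fun i : Fin k => (rotate k 2)^[i.val] x)).card = k ∧
    ∀ i j : ZMod k,
      (dbAdj k 2 ((rotate k 2)^[i.val] x) ((rotate k 2)^[j.val] x) ↔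
        j - i = 1 ∨ j - i = -1) := by
  have : Fact k.Prime := ⟨hk⟩
  constructor
  · rw [Finset.card_image_of_injective, Finset.card_univ, Fintype.card_fin]
    intro i j h
    have hcast := (rotate_iterate_eq_iff hx i.val j.val).mp h
    rw [ZMod.natCast_eq_natCast_iff', Nat.mod_eq_of_lt i.isLt, Nat.mod_eq_of_lt j.isLt] at hcast
    exact Fin.ext hcast
  · intro i j
    rw [dbAdj, Ne, rotate_iterate_eq_iff hx, shifts_rotate_iterate_iff hx,
      shifts_rotate_iterate_iff hx]
    simp only [ZMod.natCast_zmod_val]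
    rw [← neg_sub j i, neg_eq_iff_eq_neg, and_iff_right_of_imp]
    rintro h rfl
    simp at h
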